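/- Let A ⊆ H be an affine commutative-by-finite Hopf algebra satisfying (OrbSemi), with A semiprime or central in H, or H pointed, and let ρ = (id ⊗ ι°)∘Δ be the right A°-comodule structure of H°. Then for each g ∈ G_H: (i) ι°(ĝ) = ⊕_{h∼g} kχ_h; (ii) {f ∈ H° : ρ(f) ∈ f ⊗ Σ_{h∼g} kχ_h} ⊆ ĝ; (iii) 1̂_{G_H} = H̄* = {f ∈ H° : ρ(f) = f ⊗ 1}. -/

import Mathlib

open TensorProduct LinearMap Coalgebra

namespace Paper

noncomputable section

variable (k : Type) [Field k]

section Coalg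

variable {C : Type} [AddCommMonoid C] [Module k C] [Coalgebra k C]

/-- Convolution product on the linear dual of a coalgebra. -/
noncomputable def conv (f g : Module.Dual k C) : Module.Dual k C :=
  (TensorProduct.lid k k).toLinearMap ∘ₗ TensorProduct.map f g ∘ₗ Coalgebra.comul

/-- The unit of the convolution algebra on the dual: the counit. -/
noncomputable def convOne : Module.Dual k C := Coalgebra.counit

/-- Iterated convolution power. -/
noncomputable def convPow (f : Module.Dual k C) : ℕ → Module.Dual k C
  | 0 => convOne k
  | n + 1 => conv k f (convPow f n)

end Coalg

/-- The finite dual of an algebra: functionals vanishing on a two-sided ideal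
of finite codimension. -/
def finDual (H : Type) [Ring H] [Algebra k H] : Set (Module.Dual k H) :=
  {f | ∃ I : Submodule k H, (∀ (h : H), ∀ x ∈ I, h * x ∈ I ∧ x * h ∈ I) ∧
    I ≤ LinearMap.ker f ∧ FiniteDimensional k (H ⧸ I)}

section Hopf

variable (H : Type) [Ring H] [HopfAlgebra k H]

/-- Left adjoint action `(ad_ℓ h)(a) = Σ h₁ a S(h₂)`. -/
noncomputable def adl (h a : H) : H :=
  TensorProduct.lift (((LinearMap.mul k H).comp (LinearMap.mulRight k a)).compl₂
    (HopfAlgebra.antipode (R := k))) (Coalgebra.comul h)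

/-- Right adjoint action `(ad_r h)(a) = Σ S(h₁) a h₂`. -/
noncomputable def adr (h a : H) : H :=
  TensorProduct.lift ((LinearMap.mul k H).comp ((LinearMap.mulRight k a) ∘ₗ
    (HopfAlgebra.antipode (R := k)))) (Coalgebra.comul h)

/-- Left adjoint action on the dual: `(ad_ℓ φ)(f) = Σ φ₁ f S°(φ₂)`, i.e.
`h ↦ Σ φ(h₁ S(h₃)) f(h₂)`. -/
noncomputable def adld (φ f : Module.Dual k H) : Module.Dual k H :=
  (TensorProduct.lid k k).toLinearMap ∘ₗ
    TensorProduct.map (φ ∘ₗ LinearMap.mul' k H ∘ₗ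
      (HopfAlgebra.antipode (R := k)).lTensor H) f ∘ₗ
    (TensorProduct.assoc k H H H).symm.toLinearMap ∘ₗ
    ((TensorProduct.comm k H H).toLinearMap.lTensor H) ∘ₗ
    ((Coalgebra.comul (R := k) (A := H)).lTensor H) ∘ₗ
    Coalgebra.comul

/-- Right adjoint action on the dual: `(ad_r φ)(f) = Σ S°(φ₁) f φ₂`, i.e.
`h ↦ Σ φ(S(h₁) h₃) f(h₂)`. -/
noncomputable def adrd (φ f : Module.Dual k H) : Module.Dual k H :=
  (TensorProduct.lid k k).toLinearMap ∘ₗ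
    TensorProduct.map (φ ∘ₗ LinearMap.mul' k H ∘ₗ
      (HopfAlgebra.antipode (R := k)).rTensor H) f ∘ₗ
    (TensorProduct.assoc k H H H).symm.toLinearMap ∘ₗ
    ((TensorProduct.comm k H H).toLinearMap.lTensor H) ∘ₗ
    ((Coalgebra.comul (R := k) (A := H)).lTensor H) ∘ₗ
    Coalgebra.comul

/-- A submodule is a subcoalgebra if its image under `comul` lies in `V ⊗ V`. -/
def IsSubcoalgebra (V : Submodule k H) : Prop :=
  ∀ x ∈ V, Coalgebra.comul (R := k) x ∈
    LinearMap.range (TensorProduct.map V.subtype V.subtype)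

/-- A Hopf algebra is pointed if every simple subcoalgebra is one-dimensional. -/
def IsPointedHopf : Prop :=
  ∀ V : Submodule k H, IsSubcoalgebra k H V → V ≠ ⊥ →
    (∀ W : Submodule k H, W ≤ V → IsSubcoalgebra k H W → W = ⊥ ∨ W = V) →
    Module.finrank k ↥V = 1

/-- A coideal: `ε(X) = 0` and `Δ(X) ⊆ X ⊗ H + H ⊗ X`. -/
def IsCoideal (X : Submodule k H) : Prop :=
  (∀ x ∈ X, Coalgebra.counit (R := k) x = 0) ∧
  (∀ x ∈ X, Coalgebra.comul (R := k) x ∈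
    LinearMap.range (TensorProduct.map X.subtype (LinearMap.id (M := H))) ⊔
    LinearMap.range (TensorProduct.map (LinearMap.id (M := H)) X.subtype))

/-- `S` is a Hopf subalgebra of the finite dual `H°` (with its convolution
product; closure under the coproduct is expressed in pairing form). -/
def IsHopfSubalgSet (S : Set (Module.Dual k H)) : Prop :=
  S ⊆ finDual k H ∧ convOne k ∈ S ∧
  (∀ f g, f ∈ S → g ∈ S → f + g ∈ S ∧ conv k f g ∈ S) ∧
  (∀ (c : k), ∀ f ∈ S, c • f ∈ S) ∧
  (∀ f ∈ S, f ∘ₗ HopfAlgebra.antipode (R := k) ∈ S) ∧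
  (∀ f ∈ S, ∃ (n : ℕ) (s t : Fin n → Module.Dual k H),
    (∀ i, s i ∈ S ∧ t i ∈ S) ∧ ∀ x y : H, f (x * y) = ∑ i, s i x * t i y)

end Hopf

section Ext

variable (A : Type) [CommRing A] [HopfAlgebra k A]
variable (H : Type) [Ring H] [HopfAlgebra k H]

/-- The submodule `A⁺H` of `H` (image of the augmentation ideal times `H`). -/
def augHIdeal (ι : A →ₗ[k] H) : Submodule k H :=
  Submodule.span k
    {x : H | ∃ (a : A) (h : H), Coalgebra.counit (R := k) a = 0 ∧ x = ι a * h}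

/-- The subset of the dual of `H` corresponding to `H̄* = (H/A⁺H)*`:
functionals vanishing on `A⁺H`. -/
def hbarStar (ι : A →ₗ[k] H) : Set (Module.Dual k H) :=
  {f | ∀ x ∈ augHIdeal k A H ι, f x = 0}

/-- The tangential component `W(H°)`. -/
def tangential (ι : A →ₗ[k] H) : Set (Module.Dual k H) :=
  {f | f ∈ finDual k H ∧ ∃ n : ℕ, 0 < n ∧ ∀ x ∈ (augHIdeal k A H ι) ^ n, f x = 0}

/-- The augmentation ideal of the commutative Hopf algebra `A`. -/
def augIdeal : Ideal A := RingHom.ker (Bialgebra.counitAlgHom k A)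

/-- The irreducible component `A'` of `A°` containing the counit:
functionals vanishing on a power of the augmentation ideal. -/
def Aprime : Set (Module.Dual k A) :=
  {f | ∃ n : ℕ, 0 < n ∧ ∀ x ∈ (augIdeal k A) ^ n, f x = 0}

/-- The Lie algebra `𝔤` of `G_H`: primitive functionals on `A`. -/
def gLie : Set (Module.Dual k A) :=
  {f | f 1 = 0 ∧ ∀ x y : A, f (x * y) =
    f x * Coalgebra.counit (R := k) y + Coalgebra.counit (R := k) x * f y}

/-- An ideal of `A` is `H̄`-stable if it is stable under the (left) adjoint
action of `H` on `A` (which factors through `H̄`). -/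
def IsHStable (ι : A →ₗ[k] H) (I : Ideal A) : Prop :=
  ∀ (h : H), ∀ a ∈ I, ∃ b ∈ I, ι b = adl k H h (ι a)

/-- `mc` is the `H̄`-core of `m`: the largest `H̄`-stable ideal of `A`
contained in `m`. -/
def IsCore (ι : A →ₗ[k] H) (m mc : Ideal A) : Prop :=
  IsHStable k A H ι mc ∧ mc ≤ m ∧
    ∀ I : Ideal A, IsHStable k A H ι I → I ≤ m → I ≤ mc

/-- The submodule `H·J` of `H`, for an ideal `J` of `A`. -/
def leftMul (ι : A →ₗ[k] H) (J : Ideal A) : Submodule k H :=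
  Submodule.span k {x : H | ∃ (h : H), ∃ a ∈ J, x = h * ι a}

/-- The submodule `J·H` of `H`, for an ideal `J` of `A`. -/
def rightMul (ι : A →ₗ[k] H) (J : Ideal A) : Submodule k H :=
  Submodule.span k {x : H | ∃ (h : H), ∃ a ∈ J, x = ι a * h}

/-- The subcoalgebra `ĝ := (H/H m_g^{(H̄)})*` of `H°`, as a submodule of the dual. -/
def ghat (ι : A →ₗ[k] H) (core : Ideal A → Ideal A) (g : A →ₐ[k] k) :
    Submodule k (Module.Dual k H) :=
  (leftMul k A H ι (core (RingHom.ker g))).dualAnnihilator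

/-- The character component `k̂G_H` of `H°`. -/
def charComp (ι : A →ₗ[k] H) (core : Ideal A → Ideal A) :
    Set (Module.Dual k H) :=
  {f | ∃ s : Finset (A →ₐ[k] k), s.Nonempty ∧
    ∀ x ∈ ⨅ g ∈ s, leftMul k A H ι (core (RingHom.ker g)), f x = 0}

/-- Hypothesis (OrbSemi): all orbit algebras `A/m^{(H̄)}` are semisimple. -/
def OrbSemi (core : Ideal A → Ideal A) : Prop :=
  ∀ m : Ideal A, m.IsMaximal → IsSemisimpleRing (A ⧸ core m)

/-- Restriction of functionals along `ι` : the map `ι° : H° → A°`. -/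
def iotaDual (ι : A →ₗ[k] H) (f : Module.Dual k H) : Module.Dual k A := f ∘ₗ ι

/-- Coextension of functionals along the projection `Π : H → A`:
the map `Π° : A° → H°`. -/
def PiDual (p : H →ₗ[k] A) (α : Module.Dual k A) : Module.Dual k H := α ∘ₗ p

/-- `A ⊆ H` is an affine commutative-by-finite Hopf algebra, where the
inclusion of the commutative normal Hopf subalgebra `A` is recorded by the
injective Hopf algebra map `ι`. -/
structure CommByFinite (ι : A →ₗ[k] H) : Prop where
  ι_inj : Function.Injective ι
  ι_one : ι 1 = 1
  ι_mul : ∀ a b : A, ι (a * b) = ι a * ι b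
  ι_comul : ∀ a : A,
    Coalgebra.comul (R := k) (ι a) = TensorProduct.map ι ι (Coalgebra.comul a)
  ι_counit : ∀ a : A,
    Coalgebra.counit (R := k) (ι a) = Coalgebra.counit (R := k) a
  ι_antipode : ∀ a : A,
    ι (HopfAlgebra.antipode (R := k) a) = HopfAlgebra.antipode (R := k) (ι a)
  affine : ∃ s : Finset A, Algebra.adjoin k (s : Set A) = ⊤
  normal_left : ∀ (h : H) (a : A), adl k H h (ι a) ∈ Set.range ι
  normal_right : ∀ (h : H) (a : A), adr k H h (ι a) ∈ Set.range ι
  finiteOver : ∃ s : Finset H,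
    Submodule.span k {x : H | ∃ (a : A), ∃ y ∈ s, x = ι a * y} = ⊤

/-- The standing hypothesis: `A` is semiprime (reduced) or central in `H`,
or `H` is pointed. -/
def StandingHyp (ι : A →ₗ[k] H) : Prop :=
  IsReduced A ∨ (∀ (a : A) (h : H), ι a * h = h * ι a) ∨ IsPointedHopf k H

/-- `Π : H → A` is the projection of a direct sum decomposition
`H = A ⊕ X` of right `A`-modules. -/
structure IsSplitting (ι : A →ₗ[k] H) (p : H →ₗ[k] A) : Prop where
  left_inv : ∀ a : A, p (ι a) = a
  right_linear : ∀ (h : H) (a : A), p (h * ι a) = p h * a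

/-- Hypothesis (CoSplit) for a given splitting `Π`: the complement
`X = ker Π` is a coideal of `H`. -/
def CoSplit (p : H →ₗ[k] A) : Prop := IsCoideal k H (LinearMap.ker p)

end Ext

section Quot

variable (A : Type) [CommRing A] [HopfAlgebra k A]
variable (H : Type) [Ring H] [HopfAlgebra k H]
variable (Hb : Type) [Ring Hb] [HopfAlgebra k Hb]

/-- `π : H → H̄` realises `H̄` as the quotient Hopf algebra `H/A⁺H`. -/
structure IsHbarQuotient (ι : A →ₗ[k] H) (π : H →ₗ[k] Hb) : Prop where
  π_surj : Function.Surjective π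
  π_one : π 1 = 1
  π_mul : ∀ x y : H, π (x * y) = π x * π y
  π_comul : ∀ x : H,
    Coalgebra.comul (R := k) (π x) = TensorProduct.map π π (Coalgebra.comul x)
  π_counit : ∀ x : H,
    Coalgebra.counit (R := k) (π x) = Coalgebra.counit (R := k) x
  π_antipode : ∀ x : H,
    π (HopfAlgebra.antipode (R := k) x) = HopfAlgebra.antipode (R := k) (π x)
  π_ker : LinearMap.ker π = augHIdeal k A H ι
  findim : FiniteDimensional k Hb

/-- Composition with `π` : the map `π° : H̄* → H°`. -/
def piDual (π : H →ₗ[k] Hb) (β : Module.Dual k Hb) : Module.Dual k H := β ∘ₗ π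

end Quot

end

end Paper

namespace Paper

section Helpers

variable (k : Type) [Field k]
variable (A : Type) [CommRing A] [HopfAlgebra k A]
variable (H : Type) [Ring H] [HopfAlgebra k H]

/-- linear form of `adl`. -/
noncomputable def adlT (x : H) : H ⊗[k] H →ₗ[k] H :=
  TensorProduct.lift (((LinearMap.mul k H).comp (LinearMap.mulRight k x)).compl₂
    (HopfAlgebra.antipode (R := k)))

noncomputable def adrT (x : H) : H ⊗[k] H →ₗ[k] H :=
  TensorProduct.lift ((LinearMap.mul k H).comp ((LinearMap.mulRight k x) ∘ₗ
    (HopfAlgebra.antipode (R := k))))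

theorem adl_eq (h x : H) : adl k H h x = adlT k H x (Coalgebra.comul h) := rfl

theorem adr_eq (h x : H) : adr k H h x = adrT k H x (Coalgebra.comul h) := rfl

theorem adlT_tmul (x p q : H) :
    adlT k H x (p ⊗ₜ q) = p * x * HopfAlgebra.antipode (R := k) q := by
  simp [adlT]

theorem adrT_tmul (x p q : H) :
    adrT k H x (p ⊗ₜ q) = HopfAlgebra.antipode (R := k) p * x * q := by
  simp [adrT]

theorem mul_eq_adl (h x : H) :
    h * x = LinearMap.mul' k H
      ((adlT k H x ∘ₗ Coalgebra.comul).rTensor H (Coalgebra.comul h)) := by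
  have e1 : LinearMap.mul' k H ∘ₗ (adlT k H x).rTensor H
      = (LinearMap.mul' k H ∘ₗ TensorProduct.map (LinearMap.mulRight k x)
        (LinearMap.mul' k H ∘ₗ (HopfAlgebra.antipode (R := k)).rTensor H)) ∘ₗ
        (TensorProduct.assoc k H H H).toLinearMap := by
    ext p q r
    simp [adlT_tmul, mul_assoc]
  have e2 := LinearMap.congr_fun e1 ((Coalgebra.comul (R := k)).rTensor H (Coalgebra.comul h))
  rw [LinearMap.rTensor_comp]
  simp only [LinearMap.comp_apply, LinearEquiv.coe_coe, Coalgebra.coassoc_apply] at e2 ⊢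
  rw [e2]
  have e3 : (TensorProduct.map (LinearMap.mulRight k x)
      (LinearMap.mul' k H ∘ₗ (HopfAlgebra.antipode (R := k)).rTensor H)) ∘ₗ
        (Coalgebra.comul (R := k)).lTensor H
      = TensorProduct.map (LinearMap.mulRight k x) (Algebra.linearMap k H) ∘ₗ
        (Coalgebra.counit (R := k)).lTensor H := by
    ext p q
    simp
  have e4 := LinearMap.congr_fun e3 (Coalgebra.comul h)
  simp only [LinearMap.comp_apply] at e4
  rw [e4, Coalgebra.lTensor_counit_comul]
  simp

theorem mul_eq_adr (h x : H) :
    x * h = LinearMap.mul' k H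
      ((adrT k H x ∘ₗ Coalgebra.comul).lTensor H (Coalgebra.comul h)) := by
  have e1 : LinearMap.mul' k H ∘ₗ (adrT k H x).lTensor H
      = (LinearMap.mul' k H ∘ₗ TensorProduct.map 
        (LinearMap.mul' k H ∘ₗ (HopfAlgebra.antipode (R := k)).lTensor H)
        (LinearMap.mulLeft k x)) ∘ₗ
        (TensorProduct.assoc k H H H).symm.toLinearMap := by
    ext p q r
    simp [adrT_tmul, mul_assoc]
  have e2 := LinearMap.congr_fun e1 ((Coalgebra.comul (R := k)).lTensor H (Coalgebra.comul h))
  rw [LinearMap.lTensor_comp]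
  simp only [LinearMap.comp_apply, LinearEquiv.coe_coe, Coalgebra.coassoc_symm_apply] at e2 ⊢
  rw [e2]
  have e3 : (TensorProduct.map 
      (LinearMap.mul' k H ∘ₗ (HopfAlgebra.antipode (R := k)).lTensor H)
      (LinearMap.mulLeft k x)) ∘ₗ
        (Coalgebra.comul (R := k)).rTensor H
      = TensorProduct.map (Algebra.linearMap k H) (LinearMap.mulLeft k x) ∘ₗ
        (Coalgebra.counit (R := k)).rTensor H := by
    ext p q
    simp
  have e4 := LinearMap.congr_fun e3 (Coalgebra.comul h)
  simp only [LinearMap.comp_apply] at e4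
  rw [e4, Coalgebra.rTensor_counit_comul]
  simp

variable {k A H}
variable {ι : A →ₗ[k] H}

theorem mem_rightMul {J : Ideal A} {a : A} (ha : a ∈ J) (h : H) :
    ι a * h ∈ rightMul k A H ι J := Submodule.subset_span ⟨h, a, ha, rfl⟩

theorem mem_leftMul {J : Ideal A} {a : A} (ha : a ∈ J) (h : H) :
    h * ι a ∈ leftMul k A H ι J := Submodule.subset_span ⟨h, a, ha, rfl⟩

theorem rightMul_mul {J : Ideal A} {x : H} (hx : x ∈ rightMul k A H ι J) (h : H) :
    x * h ∈ rightMul k A H ι J := by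
  induction hx using Submodule.span_induction with
  | mem x hx =>
    obtain ⟨y, a, ha, rfl⟩ := hx
    rw [mul_assoc]; exact mem_rightMul ha _
  | zero => simp
  | add x y _ _ hx hy => rw [add_mul]; exact add_mem hx hy
  | smul c x _ hx => rw [smul_mul_assoc]; exact Submodule.smul_mem _ _ hx

theorem mul_iota_mem {J : Ideal A} (hJ : IsHStable k A H ι J) {a : A} (ha : a ∈ J) (h : H) :
    h * ι a ∈ rightMul k A H ι J := by
  rw [mul_eq_adl k H h]
  generalize Coalgebra.comul (R := k) h = t
  induction t using TensorProduct.induction_on with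
  | zero => simp
  | add x y hx hy => rw [map_add, map_add]; exact add_mem hx hy
  | tmul p q =>
    obtain ⟨b, hb, e⟩ := hJ p a ha
    rw [adl_eq] at e
    simp only [LinearMap.rTensor_tmul, LinearMap.comp_apply, LinearMap.mul'_apply, ← e]
    exact mem_rightMul hb _

theorem mul_rightMul {J : Ideal A} (hJ : IsHStable k A H ι J) {x : H}
    (hx : x ∈ rightMul k A H ι J) (h : H) :
    h * x ∈ rightMul k A H ι J := by
  induction hx using Submodule.span_induction with
  | mem x hx =>
    obtain ⟨y, a, ha, rfl⟩ := hx
    rw [← mul_assoc]; exact rightMul_mul (mul_iota_mem hJ ha _) _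
  | zero => simp
  | add x y _ _ hx hy => rw [mul_add]; exact add_mem hx hy
  | smul c x _ hx => rw [mul_smul_comm]; exact Submodule.smul_mem _ _ hx

theorem leftMul_le {J : Ideal A} (hJ : IsHStable k A H ι J) :
    leftMul k A H ι J ≤ rightMul k A H ι J := by
  refine Submodule.span_le.2 ?_
  rintro _ ⟨h, a, ha, rfl⟩
  exact mul_iota_mem hJ ha h

/-- contraction: `JH ∩ A ⊆ rad J`. -/
theorem contraction (hC : CommByFinite k A H ι) {J : Ideal A} (hr : J.IsRadical) {a : A}
    (ha : ι a ∈ rightMul k A H ι J) : a ∈ J := by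
  let ιr : A →+* H :=
    { toFun := ι, map_one' := hC.ι_one, map_mul' := hC.ι_mul, map_zero' := map_zero ι,
      map_add' := map_add ι }
  letI : Module A H := Module.compHom H ιr
  have sm : ∀ (a : A) (h : H), a • h = ι a * h := fun _ _ => rfl
  have hk : ∀ (c : k) (h : H), c • h = (algebraMap k A c) • h := by
    intro c h
    rw [sm, Algebra.algebraMap_eq_smul_one, map_smul, hC.ι_one, smul_mul_assoc, one_mul]
  haveI : Module.Finite A H := by
    obtain ⟨s, hs⟩ := hC.finiteOver
    refine ⟨⟨s, ?_⟩⟩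
    rw [eq_top_iff]
    intro x _
    have hx : x ∈ Submodule.span k {x : H | ∃ (a : A), ∃ y ∈ s, x = ι a * y} := by
      rw [hs]; trivial
    induction hx using Submodule.span_induction with
    | mem x hx =>
      obtain ⟨a, y, hy, rfl⟩ := hx
      exact Submodule.smul_mem _ a (Submodule.subset_span hy)
    | zero => simp
    | add x y _ _ hx hy => exact add_mem (hx trivial) (hy trivial)
    | smul c x _ hx => rw [hk]; exact Submodule.smul_mem _ _ (hx trivial)
  have hle : ∀ x ∈ rightMul k A H ι J, x ∈ J • (⊤ : Submodule A H) := by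
    intro x hx
    induction hx using Submodule.span_induction with
    | mem x hx =>
      obtain ⟨h, a, ha, rfl⟩ := hx
      exact Submodule.smul_mem_smul ha (Submodule.mem_top (x := h))
    | zero => simp
    | add x y _ _ hx hy => exact add_mem hx hy
    | smul c x _ hx => rw [hk]; exact Submodule.smul_mem _ _ hx
  obtain ⟨p, hp, -, hpc, hp0⟩ :=
    LinearMap.exists_monic_and_natDegree_eq_and_coeff_mem_pow_and_aeval_eq_zero A
      (algebraMap A (Module.End A H) a) J (by
        rintro _ ⟨x, rfl⟩
        exact hle _ (rightMul_mul ha x))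
  have e : p.eval a = 0 := by
    rw [Polynomial.aeval_algebraMap_apply] at hp0
    have := LinearMap.congr_fun hp0 (1 : H)
    simp only [Module.algebraMap_end_apply, sm, mul_one, LinearMap.zero_apply,
      Polynomial.coe_aeval_eq_eval] at this
    exact hC.ι_inj (by rw [this, map_zero])
  apply hr
  refine ⟨p.natDegree, ?_⟩
  rw [Polynomial.eval_eq_sum_range, Finset.sum_range_succ, hp.coeff_natDegree, one_mul] at e
  rw [eq_neg_of_add_eq_zero_right e]
  refine J.neg_mem (J.sum_mem fun i hi => J.mul_mem_right _ ?_)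
  have := hpc i
  have hi := Finset.mem_range.1 hi
  exact Ideal.pow_le_self (by omega) this

theorem isRadical_of_ss {J : Ideal A} (h : IsSemisimpleRing (A ⧸ J)) : J.IsRadical := by
  rw [Ideal.isRadical_iff_quotient_reduced]
  infer_instance

theorem core_le (hC : CommByFinite k A H ι) {J K m m' : Ideal A} (hm : m.IsPrime)
    (hm' : m' ≠ ⊤) (hss : IsSemisimpleRing (A ⧸ J)) (hJ : IsCore k A H ι m J)
    (hK : IsCore k A H ι m' K) (hle : J ≤ m') : K = J := by
  have hJK : J ≤ K := hK.2.2 J hJ.1 hle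
  refine le_antisymm ?_ hJK
  let Q : Ideal A :=
    { carrier := {a | ∀ c ∈ K, a * c ∈ J}
      zero_mem' := fun c _ => by simp
      add_mem' := fun {a b} ha hb c hc => by
        rw [add_mul]; exact J.add_mem (ha c hc) (hb c hc)
      smul_mem' := fun r a ha c hc => by
        rw [smul_eq_mul, mul_assoc]; exact J.mul_mem_left _ (ha c hc) }
  have hQ : IsHStable k A H ι Q := by
    intro h a ha
    obtain ⟨b, hb⟩ := hC.normal_left h a
    refine ⟨b, ?_, hb⟩
    intro c hc
    apply contraction hC (isRadical_of_ss hss)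
    rw [hC.ι_mul, hb, adl_eq]
    generalize Coalgebra.comul (R := k) h = t
    induction t using TensorProduct.induction_on with
    | zero => simp
    | add x y hx hy => rw [map_add, add_mul]; exact add_mem hx hy
    | tmul p q =>
      rw [adlT_tmul, mul_assoc, mul_assoc]
      apply mul_rightMul hJ.1
      have := mul_iota_mem hK.1 hc (HopfAlgebra.antipode (R := k) q)
      generalize HopfAlgebra.antipode (R := k) q * ι c = z at this
      induction this using Submodule.span_induction with
      | mem x hx =>
        obtain ⟨y, d, hd, rfl⟩ := hx
        rw [← mul_assoc, ← hC.ι_mul]; exact mem_rightMul (ha d hd) _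
      | zero => simp
      | add x y _ _ hx hy => rw [mul_add]; exact add_mem hx hy
      | smul c x _ hx => rw [mul_smul_comm]; exact Submodule.smul_mem _ _ hx
  by_cases hKm : K ≤ m
  · exact hJ.2.2 K hK.1 hKm
  exfalso
  have hQm : Q ≤ m := by
    obtain ⟨c, hc, hcm⟩ := Set.not_subset.1 hKm
    intro a ha
    exact (hm.mem_or_mem (hJ.2.1 (ha c hc))).resolve_right hcm
  have hQJ : Q ≤ J := hJ.2.2 Q hQ hQm
  obtain ⟨L, hL⟩ := exists_isCompl (K.map (Ideal.Quotient.mk J))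
  have hLQ : L.comap (Ideal.Quotient.mk J) ≤ Q := by
    intro a ha c hc
    rw [← Ideal.Quotient.eq_zero_iff_mem, map_mul]
    have : Ideal.Quotient.mk J a * Ideal.Quotient.mk J c ∈ K.map (Ideal.Quotient.mk J) ⊓ L :=
      ⟨Ideal.mul_mem_left _ _ (Ideal.mem_map_of_mem _ hc), Ideal.mul_mem_right _ _ ha⟩
    rwa [hL.inf_eq_bot] at this
  have hL0 : L = ⊥ := by
    rw [eq_bot_iff]
    intro x hx
    obtain ⟨a, rfl⟩ := Ideal.Quotient.mk_surjective x
    exact Ideal.Quotient.eq_zero_iff_mem.2 (hQJ (hLQ hx))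
  have hT := hL.sup_eq_top
  rw [hL0, sup_bot_eq] at hT
  apply hm'
  rw [Ideal.eq_top_iff_one]
  apply hK.2.1
  have h1 : (1 : A) ∈ (K.map (Ideal.Quotient.mk J)).comap (Ideal.Quotient.mk J) := by
    rw [hT]; trivial
  rw [Ideal.comap_map_of_surjective _ Ideal.Quotient.mk_surjective] at h1
  refine (sup_le le_rfl ?_ : K ⊔ _ ≤ K) h1
  intro x hx
  exact hJK (Ideal.Quotient.eq_zero_iff_mem.1 hx)

theorem exists_char [IsAlgClosed k] (hA : Algebra.FiniteType k A) (M : Ideal A)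
    (hM : M.IsMaximal) : ∃ h : A →ₐ[k] k, RingHom.ker h = M := by
  letI := Ideal.Quotient.field M
  haveI : Module.Finite k (A ⧸ M) := finite_of_finite_type_of_isJacobsonRing k (A ⧸ M)
  have hb := IsAlgClosed.algebraMap_bijective_of_isIntegral (k := k) (K := A ⧸ M)
  let e : k ≃ₐ[k] (A ⧸ M) := AlgEquiv.ofBijective (Algebra.ofId k (A ⧸ M)) hb
  refine ⟨(e.symm : (A ⧸ M) →ₐ[k] k).comp (Ideal.Quotient.mkₐ k M), ?_⟩
  ext x
  simp [RingHom.mem_ker, Ideal.Quotient.eq_zero_iff_mem]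

theorem exists_chars [IsAlgClosed k] (hA : Algebra.FiniteType k A) (J : Ideal A)
    (hss : IsSemisimpleRing (A ⧸ J)) :
    ∃ χ : MaximalSpectrum (A ⧸ J) → (A →ₐ[k] k), ∀ x, x ∈ J ↔ ∀ i, χ i x = 0 := by
  have := fun M : MaximalSpectrum (A ⧸ J) =>
    exists_char hA (M.asIdeal.comap (Ideal.Quotient.mk J))
      (have := M.isMaximal
       Ideal.comap_isMaximal_of_surjective _ Ideal.Quotient.mk_surjective)
  choose χ hχ using this
  refine ⟨χ, fun x => ?_⟩
  have hx : ∀ i, χ i x = 0 ↔ Ideal.Quotient.mk J x ∈ i.asIdeal := by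
    intro i
    rw [← RingHom.mem_ker, hχ, Ideal.mem_comap]
  simp only [hx]
  constructor
  · intro h i
    rw [Ideal.Quotient.eq_zero_iff_mem.2 h]; exact zero_mem _
  · intro h
    rw [← Ideal.Quotient.eq_zero_iff_mem]
    apply (IsArtinianRing.equivPi (A ⧸ J)).injective
    ext i
    rw [IsArtinianRing.equivPi_apply, map_zero]
    exact Ideal.Quotient.eq_zero_iff_mem.2 (h i)

theorem finCodim (hC : CommByFinite k A H ι) [IsAlgClosed k] (hA : Algebra.FiniteType k A)
    (J : Ideal A) (hss : IsSemisimpleRing (A ⧸ J)) :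
    FiniteDimensional k (H ⧸ rightMul k A H ι J) := by
  obtain ⟨χ, hχ⟩ := exists_chars hA J hss
  let Φ : A →ₗ[k] (MaximalSpectrum (A ⧸ J) → k) := LinearMap.pi fun i => (χ i).toLinearMap
  have hΦ : ∀ x, Φ x = 0 ↔ x ∈ J := fun x => by
    rw [hχ, funext_iff]; rfl
  let φ : H → A →ₗ[k] (H ⧸ rightMul k A H ι J) := fun y =>
    (rightMul k A H ι J).mkQ ∘ₗ LinearMap.mulRight k y ∘ₗ ι
  haveI : Module.Finite k (A ⧸ LinearMap.ker Φ) :=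
    Module.Finite.equiv Φ.quotKerEquivRange.symm
  have hle : ∀ y, LinearMap.ker Φ ≤ LinearMap.ker (φ y) := by
    intro y x hx
    have : x ∈ J := (hΦ x).1 hx
    simp only [φ, LinearMap.mem_ker, LinearMap.comp_apply, LinearMap.mulRight_apply,
      Submodule.mkQ_apply, Submodule.Quotient.mk_eq_zero]
    exact mem_rightMul this y
  obtain ⟨s, hs⟩ := hC.finiteOver
  have hfg : ∀ y, (LinearMap.range (φ y)).FG := by
    intro y
    rw [← Submodule.range_liftQ _ _ (hle y), ← Submodule.map_top]
    exact Submodule.FG.map _ Module.Finite.fg_top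
  have hfg2 : (⨆ y ∈ s, LinearMap.range (φ y)).FG := Submodule.fg_biSup s _ fun y _ => hfg y
  suffices htop : (⨆ y ∈ s, LinearMap.range (φ y)) = ⊤ by
    rw [htop] at hfg2
    exact ⟨hfg2⟩
  rw [eq_top_iff, ← Submodule.range_mkQ, LinearMap.range_eq_map, ← hs, Submodule.map_span_le]
  rintro _ ⟨a, y, hy, rfl⟩
  exact Submodule.mem_iSup_of_mem y (Submodule.mem_iSup_of_mem hy ⟨a, rfl⟩)

theorem exists_ext (hC : CommByFinite k A H ι) [IsAlgClosed k] (hA : Algebra.FiniteType k A)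
    (J : Ideal A) (hss : IsSemisimpleRing (A ⧸ J)) (hJ : IsHStable k A H ι J)
    (α : Module.Dual k A) (hα : ∀ a ∈ J, α a = 0) :
    ∃ f : Module.Dual k H, f ∈ (leftMul k A H ι J).dualAnnihilator ∧ f ∈ finDual k H ∧
      f ∘ₗ ι = α := by
  let N := rightMul k A H ι J
  let ψ : A →ₗ[k] (H ⧸ N) := N.mkQ ∘ₗ ι
  have hker : LinearMap.ker ψ ≤ LinearMap.ker α := by
    intro a ha
    apply hα
    apply contraction hC (isRadical_of_ss hss)
    simpa [ψ, N] using ha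
  obtain ⟨β, hβ⟩ : ∃ β : Module.Dual k (H ⧸ N), β ∘ₗ ψ = α := by
    have : α ∈ LinearMap.range ψ.dualMap := by
      rw [LinearMap.range_dualMap_eq_dualAnnihilator_ker, Submodule.mem_dualAnnihilator]
      exact fun w hw => hker hw
    exact this
  have hN : ∀ x ∈ N, (β ∘ₗ N.mkQ) x = 0 := by
    intro x hx
    rw [LinearMap.comp_apply, Submodule.mkQ_apply, (Submodule.Quotient.mk_eq_zero N).2 hx,
      map_zero]
  refine ⟨β ∘ₗ N.mkQ, ?_, ⟨N, ?_, hN, finCodim hC hA J hss⟩, hβ⟩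
  · rw [Submodule.mem_dualAnnihilator]
    exact fun x hx => hN x (leftMul_le hJ hx)
  · exact fun h x hx => ⟨mul_rightMul hJ hx h, rightMul_mul hx h⟩

theorem aug_stable (hC : CommByFinite k A H ι) :
    IsHStable k A H ι (RingHom.ker (Bialgebra.counitAlgHom k A)) := by
  intro h a ha
  obtain ⟨b, hb⟩ := hC.normal_left h a
  refine ⟨b, ?_, hb⟩
  have ha' : Coalgebra.counit (R := k) (ι a) = 0 := by rw [hC.ι_counit]; exact ha
  change Coalgebra.counit (R := k) b = 0
  rw [← hC.ι_counit, hb, adl_eq]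
  generalize Coalgebra.comul (R := k) h = t
  induction t using TensorProduct.induction_on with
  | zero => simp
  | add x y hx hy => rw [map_add, map_add, hx, hy, add_zero]
  | tmul p q => rw [adlT_tmul, Bialgebra.counit_mul, Bialgebra.counit_mul, ha']; simp

theorem aug_stable_r (hC : CommByFinite k A H ι) (h : H) (a : A)
    (ha : Coalgebra.counit (R := k) a = 0) :
    ∃ b, Coalgebra.counit (R := k) b = 0 ∧ ι b = adr k H h (ι a) := by
  obtain ⟨b, hb⟩ := hC.normal_right h a
  refine ⟨b, ?_, hb⟩
  have ha' : Coalgebra.counit (R := k) (ι a) = 0 := by rw [hC.ι_counit]; exact ha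
  rw [← hC.ι_counit, hb, adr_eq]
  generalize Coalgebra.comul (R := k) h = t
  induction t using TensorProduct.induction_on with
  | zero => simp
  | add x y hx hy => rw [map_add, map_add, hx, hy, add_zero]
  | tmul p q => rw [adrT_tmul, Bialgebra.counit_mul, Bialgebra.counit_mul, ha']; simp

theorem augHIdeal_eq (hC : CommByFinite k A H ι) :
    augHIdeal k A H ι = leftMul k A H ι (RingHom.ker (Bialgebra.counitAlgHom k A)) := by
  apply le_antisymm
  · refine Submodule.span_le.2 ?_
    rintro _ ⟨a, h, ha, rfl⟩
    rw [mul_eq_adr k H h]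
    generalize Coalgebra.comul (R := k) h = t
    induction t using TensorProduct.induction_on with
    | zero => simp
    | add x y hx hy => rw [map_add, map_add]; exact add_mem hx hy
    | tmul p q =>
      obtain ⟨b, hb, e⟩ := aug_stable_r hC q a ha
      rw [adr_eq] at e
      simp only [LinearMap.lTensor_tmul, LinearMap.comp_apply, LinearMap.mul'_apply, ← e]
      exact mem_leftMul hb _
  · refine (leftMul_le (aug_stable hC)).trans (Submodule.span_le.2 ?_)
    rintro _ ⟨h, a, ha, rfl⟩
    exact Submodule.subset_span ⟨a, h, ha, rfl⟩

end Helpers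

end Paper

open Paper in
/-- Under (OrbSemi), for each `g ∈ G_H`:
(i) `ι°(ĝ) = ⊕_{h∼g} kχ_h`; (ii) `{f ∈ H° : ρ(f) ∈ f ⊗ Σ_{h∼g} kχ_h} ⊆ ĝ`;
(iii) `1̂ = H̄* = {f ∈ H° : ρ(f) = f ⊗ 1}` (where `ρ = (id ⊗ ι°)∘Δ` is the
right `A°`-comodule structure of `H°`, expressed here in pairing form). -/
theorem statement_16
    (k : Type) [Field k] [IsAlgClosed k]
    (A : Type) [CommRing A] [HopfAlgebra k A]
    (H : Type) [Ring H] [HopfAlgebra k H]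
    (ι : A →ₗ[k] H)
    (hCbF : CommByFinite k A H ι)
    (hyp : StandingHyp k A H ι)
    (core : Ideal A → Ideal A)
    (hcore : ∀ m : Ideal A, m.IsMaximal → IsCore k A H ι m (core m))
    (horb : OrbSemi A core)
    (g : A →ₐ[k] k) :
    -- (i) `ι°(ĝ) = ⊕_{h ∼ g} k χ_h`
    iotaDual k A H ι '' ((ghat k A H ι core g : Set (Module.Dual k H)) ∩ finDual k H)
      = ↑(Submodule.span k {α : Module.Dual k A | ∃ h : A →ₐ[k] k,
          core (RingHom.ker h) = core (RingHom.ker g) ∧ α = h.toLinearMap}) ∧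
    LinearIndependent k
      (fun h : {h : A →ₐ[k] k // core (RingHom.ker h) = core (RingHom.ker g)} =>
        (h.1.toLinearMap : Module.Dual k A)) ∧
    -- (ii) `{f ∈ H° : ρ(f) ∈ f ⊗ Σ_{h∼g} k χ_h} ⊆ ĝ`
    (∀ f ∈ finDual k H,
      (∃ (n : ℕ) (hs : Fin n → (A →ₐ[k] k)) (lam : Fin n → k),
        (∀ i, core (RingHom.ker (hs i)) = core (RingHom.ker g)) ∧
        ∀ (x : H) (a : A), f (x * ι a) = f x * ∑ i, lam i * hs i a) →
      f ∈ ghat k A H ι core g) ∧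
    -- (iii) `1̂_{G_H} = H̄* = {f ∈ H° : ρ(f) = f ⊗ 1}`
    finDual k H ∩ (ghat k A H ι core (Bialgebra.counitAlgHom k A) : Set (Module.Dual k H))
      = finDual k H ∩ hbarStar k A H ι ∧
    finDual k H ∩ hbarStar k A H ι
      = finDual k H ∩ {f : Module.Dual k H | ∀ (x : H) (a : A),
          f (x * ι a) = Coalgebra.counit (R := k) a * f x} := by
  have hmax : ∀ h : A →ₐ[k] k, (RingHom.ker h).IsMaximal := fun h =>
    RingHom.ker_isMaximal_of_surjective h (fun c => ⟨algebraMap k A c, by simp⟩)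
  have hA : Algebra.FiniteType k A := by
    obtain ⟨s, hs⟩ := hCbF.affine
    exact ⟨⟨s, hs⟩⟩
  have hg := hmax g
  have hss := horb _ hg
  have hJ := hcore _ hg
  have hsim : ∀ h : A →ₐ[k] k, core (RingHom.ker g) ≤ RingHom.ker h →
      core (RingHom.ker h) = core (RingHom.ker g) := fun h hle =>
    core_le hCbF hg.isPrime (hmax h).ne_top hss hJ (hcore _ (hmax h)) hle
  have hkill : ∀ h : A →ₐ[k] k, core (RingHom.ker h) = core (RingHom.ker g) →
      ∀ a ∈ core (RingHom.ker g), h a = 0 := by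
    intro h hh a ha
    rw [← hh] at ha
    exact (hcore _ (hmax h)).2.1 ha
  have hce : core (RingHom.ker (Bialgebra.counitAlgHom k A))
      = RingHom.ker (Bialgebra.counitAlgHom k A) :=
    le_antisymm (hcore _ (hmax _)).2.1 ((hcore _ (hmax _)).2.2 _ (aug_stable hCbF) le_rfl)
  refine ⟨?_, ?_, ?_, ?_, ?_⟩
  · apply Set.Subset.antisymm
    · rintro _ ⟨f, ⟨hf, -⟩, rfl⟩
      obtain ⟨χ, hχ⟩ := exists_chars hA _ hss
      have hf' : ∀ a ∈ core (RingHom.ker g), f (ι a) = 0 := by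
        intro a ha
        have := (Submodule.mem_dualAnnihilator f).1 hf _ (mem_leftMul ha (1 : H))
        rwa [one_mul] at this
      have hmem : iotaDual k A H ι f ∈
          Submodule.span k (Set.range fun i => (χ i).toLinearMap) := by
        apply mem_span_of_iInf_ker_le_ker
        intro x hx
        rw [Submodule.mem_iInf] at hx
        exact hf' x ((hχ x).2 fun i => hx i)
      refine Submodule.span_mono ?_ hmem
      rintro _ ⟨i, rfl⟩
      exact ⟨χ i, hsim _ fun x hx => (hχ x).1 hx i, rfl⟩
    · intro α hα
      have hα' : ∀ a ∈ core (RingHom.ker g), α a = 0 := by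
        intro a ha
        induction hα using Submodule.span_induction with
        | mem x hx =>
          obtain ⟨h, hh, rfl⟩ := hx
          exact hkill h hh a ha
        | zero => simp
        | add x y _ _ hx hy => rw [LinearMap.add_apply, hx, hy, add_zero]
        | smul c x _ hx => rw [LinearMap.smul_apply, hx, smul_zero]
      obtain ⟨f, h1, h2, h3⟩ := exists_ext hCbF hA _ hss hJ.1 α hα'
      exact ⟨f, ⟨h1, h2⟩, h3⟩
  · exact (linearIndependent_toLinearMap k A k).comp _ Subtype.val_injective
  · rintro f - ⟨n, hs, lam, h1, h2⟩
    refine (Submodule.mem_dualAnnihilator f).2 fun x hx => ?_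
    have : leftMul k A H ι (core (RingHom.ker g)) ≤ LinearMap.ker f := by
      refine Submodule.span_le.2 ?_
      rintro _ ⟨h, a, ha, rfl⟩
      change f (h * ι a) = 0
      rw [h2, Finset.sum_eq_zero, mul_zero]
      intro i _
      rw [hkill _ (h1 i) a ha, mul_zero]
    exact this hx
  · ext f
    simp only [Set.mem_inter_iff, SetLike.mem_coe, ghat, hce, hbarStar, augHIdeal_eq hCbF,
      Submodule.mem_dualAnnihilator, Set.mem_setOf_eq]
  · ext f
    simp only [Set.mem_inter_iff, hbarStar, augHIdeal_eq hCbF, Set.mem_setOf_eq]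
    refine and_congr_right fun _ => ⟨fun hf x a => ?_, fun hf x hx => ?_⟩
    · have hz : a - algebraMap k A (Coalgebra.counit (R := k) a) ∈
          RingHom.ker (Bialgebra.counitAlgHom k A) := by
        rw [RingHom.mem_ker]; simp
      have := hf _ (mem_leftMul hz x)
      rw [map_sub, mul_sub, map_sub, sub_eq_zero] at this
      rw [this, Algebra.algebraMap_eq_smul_one, map_smul, hCbF.ι_one, mul_smul_comm, mul_one,
        map_smul, smul_eq_mul]
    · have : leftMul k A H ι (RingHom.ker (Bialgebra.counitAlgHom k A)) ≤ LinearMap.ker f := by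
        refine Submodule.span_le.2 ?_
        rintro _ ⟨h, a, ha, rfl⟩
        change f (h * ι a) = 0
        have ha' : Coalgebra.counit (R := k) a = 0 := ha
        rw [hf, ha', zero_mul]
      exact this hx
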